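/- arXiv:1003.0881 — 3 statements merged into one kernel-verified Lean document; each statement's English description precedes it below -/
import Mathlib

section
/- For every integer n ≥ 1 and every real t, the integral of U ↦ exp(2t·Re(tr U)) over the unitary group U(n) with respect to the Haar probability measure equals the sum of the absolutely convergent series Σ_{k=0}^∞ t^{2k}/(k!)² · u_k(n). (Since tr(U + U*) = 2·Re(tr U), this is the matrix-integral identity ∫_{U(n)} exp[t·tr(U+U*)] dU = Σ_{k≥0} t^{2k} u_k(n)/(k!)².) -/
open MeasureTheory Matrix

/-- The length of the longest increasing subsequence of a permutation `σ` of `Fin k`: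
the maximal cardinality of a subset `A ⊆ Fin k` on which `σ` is strictly increasing. -/
def LIS {k : ℕ} (σ : Equiv.Perm (Fin k)) : ℕ :=
  Finset.univ.sup fun A : Finset (Fin k) =>
    if ∀ i ∈ A, ∀ j ∈ A, i < j → σ i < σ j then A.card else 0

/-- `u k n` is the number of permutations of `Fin k` whose longest increasing subsequence
has length at most `n`. -/
def u (k n : ℕ) : ℕ :=
  (Finset.univ.filter fun σ : Equiv.Perm (Fin k) => LIS σ ≤ n).card

section LongestIncreasing

variable {k : ℕ}

/-- A nontrivial permutation moves its first non-fixed point upwards. -/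
lemma Equiv.Perm.exists_first_moved {ρ : Equiv.Perm (Fin k)} (h : ρ ≠ 1) :
    ∃ i, (∀ j < i, ρ j = j) ∧ i < ρ i := by
  have hne : ∃ i, ρ i ≠ i := by
    by_contra! hc
    exact h (Equiv.ext hc)
  obtain ⟨i, hi, hmin⟩ := WellFounded.has_min (wellFounded_lt (α := Fin k)) {i | ρ i ≠ i} hne
  have hlt : ∀ j < i, ρ j = j := fun j hj => by
    by_contra hc
    exact hmin j hc hj
  refine ⟨i, hlt, lt_of_le_of_ne (le_of_not_gt fun hlt' => ?_) (Ne.symm hi)⟩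
  exact hi (ρ.injective (hlt _ hlt'))

lemma card_le_LIS {σ : Equiv.Perm (Fin k)} {A : Finset (Fin k)}
    (hA : ∀ i ∈ A, ∀ j ∈ A, i < j → σ i < σ j) : A.card ≤ LIS σ := by
  have := Finset.le_sup (f := fun A : Finset (Fin k) =>
    if ∀ i ∈ A, ∀ j ∈ A, i < j → σ i < σ j then A.card else 0) (Finset.mem_univ A)
  rwa [if_pos hA] at this

lemma exists_increasing_of_lt_LIS {σ : Equiv.Perm (Fin k)} {n : ℕ} (h : n < LIS σ) :
    ∃ A : Finset (Fin k), (∀ i ∈ A, ∀ j ∈ A, i < j → σ i < σ j) ∧ n < A.card := by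
  obtain ⟨A, -, hA⟩ := (Finset.lt_sup_iff).1 h
  split_ifs at hA with hinc
  · exact ⟨A, hinc, hA⟩
  · omega

/-- A permutation without increasing subsequence of length `n + 1` is a union of `n` decreasing
subsequences. -/
lemma exists_decreasing_coloring {σ : Equiv.Perm (Fin k)} {n : ℕ} (h : LIS σ ≤ n) :
    ∃ c : Fin k → Fin n, ∀ i j, i < j → c i = c j → σ j < σ i := by
  classical
  let S : Fin k → Finset (Finset (Fin k)) := fun i => Finset.univ.filter fun A =>
    (∀ a ∈ A, ∀ b ∈ A, a < b → σ a < σ b) ∧ ∀ a ∈ A, a < i ∧ σ a < σ i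
  let d : Fin k → ℕ := fun i => (S i).sup Finset.card
  have insert_inc : ∀ i, ∀ A ∈ S i, ∀ a ∈ insert i A, ∀ b ∈ insert i A, a < b → σ a < σ b := by
    intro i A hA a ha b hb hab
    simp only [S, Finset.mem_filter, Finset.mem_univ, true_and] at hA
    rcases Finset.mem_insert.1 ha with rfl | ha' <;> rcases Finset.mem_insert.1 hb with rfl | hb'
    · exact absurd hab (lt_irrefl _)
    · exact absurd (hA.2 b hb').1 hab.not_gt
    · exact (hA.2 a ha').2
    · exact hA.1 a ha' b hb' hab
  have card_insert : ∀ i, ∀ A ∈ S i, (insert i A).card = A.card + 1 := by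
    intro i A hA
    simp only [S, Finset.mem_filter, Finset.mem_univ, true_and] at hA
    exact Finset.card_insert_of_notMem fun hi => lt_irrefl _ (hA.2 i hi).1
  have exists_max : ∀ i, ∃ A ∈ S i, A.card = d i := by
    intro i
    obtain ⟨A, hA, h'⟩ := Finset.exists_mem_eq_sup (S i) ⟨∅, by simp [S]⟩ Finset.card
    exact ⟨A, hA, h'.symm⟩
  have hdn : ∀ i, d i < n := by
    intro i
    obtain ⟨A, hA, hcard⟩ := exists_max i
    have := card_le_LIS (insert_inc i A hA)
    rw [card_insert i A hA] at this
    omega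
  refine ⟨fun i => ⟨d i, hdn i⟩, fun i j hij hc => ?_⟩
  by_contra hσ
  have hσ' : σ i < σ j := lt_of_le_of_ne (not_lt.1 hσ) fun he => hij.ne (σ.injective he)
  obtain ⟨A, hA, hcard⟩ := exists_max i
  have hmem : insert i A ∈ S j := by
    have h1 := insert_inc i A hA
    simp only [S, Finset.mem_filter, Finset.mem_univ, true_and] at hA ⊢
    refine ⟨h1, fun a ha => ?_⟩
    rcases Finset.mem_insert.1 ha with rfl | ha
    · exact ⟨hij, hσ'⟩
    · exact ⟨(hA.2 a ha).1.trans hij, (hA.2 a ha).2.trans hσ'⟩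
  have hle : (insert i A).card ≤ d j := Finset.le_sup (f := Finset.card) hmem
  rw [card_insert i A hA, hcard] at hle
  have : d i = d j := congrArg Fin.val hc
  omega

end LongestIncreasing

section PermutationOperators

variable {k n : ℕ}

/-- The matrix by which a permutation acts on the `k`-th tensor power of `ℂⁿ`, in the basis
indexed by words `Fin k → Fin n`. -/
def permOp (n : ℕ) (σ : Equiv.Perm (Fin k)) : Matrix (Fin k → Fin n) (Fin k → Fin n) ℂ :=
  Matrix.of fun i j => if i ∘ σ = j then 1 else 0

lemma permOp_apply (σ : Equiv.Perm (Fin k)) (i j : Fin k → Fin n) :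
    permOp n σ i j = if i ∘ σ = j then 1 else 0 := rfl

lemma permOp_one : permOp n (1 : Equiv.Perm (Fin k)) = 1 := by
  ext i j
  simp [permOp_apply, Matrix.one_apply]

lemma permOp_mul_apply (σ : Equiv.Perm (Fin k)) (Z : Matrix (Fin k → Fin n) (Fin k → Fin n) ℂ)
    (i j : Fin k → Fin n) : (permOp n σ * Z) i j = Z (i ∘ σ) j := by
  simp [Matrix.mul_apply, permOp_apply]

lemma mul_permOp_apply (σ : Equiv.Perm (Fin k)) (Z : Matrix (Fin k → Fin n) (Fin k → Fin n) ℂ)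
    (i j : Fin k → Fin n) : (Z * permOp n σ) i j = Z i (j ∘ σ.symm) := by
  have (x : Fin k → Fin n) : x ∘ σ = j ↔ x = j ∘ σ.symm := by
    constructor
    · rintro rfl; ext; simp
    · rintro rfl; ext; simp
  simp [Matrix.mul_apply, permOp_apply, this]

lemma permOp_mul (σ τ : Equiv.Perm (Fin k)) : permOp n (σ * τ) = permOp n σ * permOp n τ := by
  ext i j
  rw [permOp_mul_apply, permOp_apply, permOp_apply, Equiv.Perm.coe_mul, Function.comp_assoc]

/-- Antisymmetrizing over more than `n` tensor factors of `ℂⁿ` gives zero. -/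
lemma sum_sign_smul_permOp_eq_zero (σ : Equiv.Perm (Fin k)) {A : Finset (Fin k)}
    (hA : n < A.card) :
    ∑ ρ : Equiv.Perm (Fin k) with ∀ x, x ∉ A → ρ x = x,
      ((Equiv.Perm.sign ρ : ℤ) : ℂ) • permOp n (σ * ρ) = 0 := by
  ext i j
  obtain ⟨a, ha, b, hb, hab, hg⟩ : ∃ a ∈ A, ∃ b ∈ A, a ≠ b ∧ i (σ a) = i (σ b) :=
    Finset.exists_ne_map_eq_of_card_lt_of_maps_to (t := Finset.univ) (by simpa using hA)
      (f := fun x => i (σ x)) (fun _ _ => by simp)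
  have hswap : ∀ x, i (σ (Equiv.swap a b x)) = i (σ x) := by
    intro x
    rw [Equiv.swap_apply_def]
    split_ifs with h1 h2
    · rw [h1, hg]
    · rw [h2, hg]
    · rfl
  rw [Matrix.sum_apply, Matrix.zero_apply]
  refine Finset.sum_involution (fun ρ _ => Equiv.swap a b * ρ) ?_ ?_ ?_ ?_
  · intro ρ _
    have : i ∘ ⇑(σ * (Equiv.swap a b * ρ)) = i ∘ ⇑(σ * ρ) := by
      ext x; simp [hswap]
    simp only [Matrix.smul_apply, permOp_apply, this]
    simp [Equiv.Perm.sign_swap hab]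
  · intro ρ _ _ h
    rw [mul_eq_right, Equiv.swap_eq_one_iff] at h
    exact hab h
  · intro ρ hρ
    simp only [Finset.mem_filter, Finset.mem_univ, true_and] at hρ ⊢
    intro x hx
    rw [Equiv.Perm.mul_apply, hρ x hx]
    exact Equiv.swap_apply_of_ne_of_ne (fun h => hx (h ▸ ha)) (fun h => hx (h ▸ hb))
  · intro ρ _
    simp [← mul_assoc]

lemma permOp_mem_span_LIS_le (σ : Equiv.Perm (Fin k)) :
    permOp n σ ∈ Submodule.span ℂ
      (Set.range fun τ : {τ : Equiv.Perm (Fin k) // LIS τ ≤ n} => permOp n τ.1) := by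
  let lex : Equiv.Perm (Fin k) → Lex (Fin k → Fin k) := fun σ => toLex ⇑σ
  induction σ using (InvImage.wf lex (wellFounded_gt)).induction with
  | _ σ ih =>
  by_cases hσ : LIS σ ≤ n
  · exact Submodule.subset_span ⟨⟨σ, hσ⟩, rfl⟩
  · obtain ⟨A, hinc, hA⟩ := exists_increasing_of_lt_LIS (not_le.1 hσ)
    have h0 := sum_sign_smul_permOp_eq_zero (n := n) σ hA
    rw [← Finset.add_sum_erase _ _ (a := 1) (by simp)] at h0
    simp only [Equiv.Perm.sign_one, Units.val_one, Int.cast_one, one_smul, mul_one] at h0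
    rw [eq_neg_of_add_eq_zero_left h0]
    refine Submodule.neg_mem _ (Submodule.sum_mem _ fun ρ hρ => Submodule.smul_mem _ _ (ih _ ?_))
    simp only [Finset.mem_erase, Finset.mem_filter, Finset.mem_univ, true_and] at hρ
    obtain ⟨i, hlt, hi⟩ := Equiv.Perm.exists_first_moved hρ.1
    have hiA : i ∈ A := by
      by_contra hc
      exact hi.ne' (hρ.2 i hc)
    have hρA : ρ i ∈ A := by
      by_contra hc
      exact hi.ne' (ρ.injective (hρ.2 _ hc))
    refine ⟨i, fun j hj => ?_, ?_⟩
    · simp [lex, hlt j hj]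
    · simpa [lex] using hinc i hiA _ hρA hi

lemma linearIndependent_permOp_LIS_le :
    LinearIndependent ℂ fun τ : {τ : Equiv.Perm (Fin k) // LIS τ ≤ n} => permOp n τ.1 := by
  let lex : {τ : Equiv.Perm (Fin k) // LIS τ ≤ n} → Lex (Fin k → Fin k) := fun σ => toLex ⇑σ.1
  rw [Fintype.linearIndependent_iff]
  intro g hg σ
  induction σ using (InvImage.wf lex (wellFounded_lt)).induction with
  | _ σ ih =>
  obtain ⟨c, hc⟩ := exists_decreasing_coloring σ.2
  have h0 := congrFun (congrFun hg (c ∘ σ.1.symm)) c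
  rw [Matrix.sum_apply, Finset.sum_eq_single σ] at h0
  · have : (c ∘ σ.1.symm) ∘ σ.1 = c := by ext; simp
    simpa [permOp_apply, this] using h0
  · intro τ _ hτ
    by_cases hcτ : (c ∘ σ.1.symm) ∘ τ.1 = c
    · have hne : σ.1⁻¹ * τ.1 ≠ 1 := fun h => hτ (Subtype.ext (inv_mul_eq_one.1 h).symm)
      obtain ⟨i, hlt, hi⟩ := Equiv.Perm.exists_first_moved hne
      rw [ih τ ?_]
      · simp
      refine ⟨i, fun j hj => ?_, ?_⟩
      · have := congrArg σ.1 (hlt j hj)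
        simpa [lex] using this
      · have := hc i _ hi (congrFun hcτ i).symm
        simpa [lex] using this
    · simp [permOp_apply, hcτ]
  · simp

/-- The permutation operators on the `k`-th tensor power of `ℂⁿ` span a space whose dimension is
the number of permutations without increasing subsequence of length `n + 1`. -/
lemma finrank_span_permOp (k n : ℕ) :
    Module.finrank ℂ (Submodule.span ℂ (Set.range (permOp (k := k) n))) = u k n := by
  have hspan : Submodule.span ℂ (Set.range (permOp (k := k) n)) = Submodule.span ℂ
      (Set.range fun τ : {τ : Equiv.Perm (Fin k) // LIS τ ≤ n} => permOp n τ.1) := by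
    apply le_antisymm
    · rw [Submodule.span_le]
      rintro _ ⟨σ, rfl⟩
      exact permOp_mem_span_LIS_le σ
    · apply Submodule.span_mono
      rintro _ ⟨σ, rfl⟩
      exact ⟨σ.1, rfl⟩
  rw [hspan, finrank_span_eq_card linearIndependent_permOp_LIS_le, Fintype.card_subtype, u]

end PermutationOperators

section TensorPower

variable {k n : ℕ}

/-- The matrix of the `k`-th tensor power of `X`. -/
def tensorPow (k : ℕ) (X : Matrix (Fin n) (Fin n) ℂ) :
    Matrix (Fin k → Fin n) (Fin k → Fin n) ℂ :=
  Matrix.of fun i j => ∏ l, X (i l) (j l)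

lemma tensorPow_apply (X : Matrix (Fin n) (Fin n) ℂ) (i j : Fin k → Fin n) :
    tensorPow k X i j = ∏ l, X (i l) (j l) := rfl

lemma tensorPow_mul (X Y : Matrix (Fin n) (Fin n) ℂ) :
    tensorPow k (X * Y) = tensorPow k X * tensorPow k Y := by
  ext i j
  simp only [tensorPow_apply, Matrix.mul_apply, Finset.prod_univ_sum, Fintype.piFinset_univ,
    Finset.prod_mul_distrib]

lemma tensorPow_diagonal (d : Fin n → ℂ) :
    tensorPow k (diagonal d) = diagonal fun i => ∏ l, d (i l) := by
  ext i j
  rw [tensorPow_apply, diagonal_apply]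
  split_ifs with h
  · subst h; simp
  · obtain ⟨l, hl⟩ := Function.ne_iff.1 h
    exact Finset.prod_eq_zero (Finset.mem_univ l) (diagonal_apply_ne _ hl)

lemma tensorPow_one : tensorPow k (1 : Matrix (Fin n) (Fin n) ℂ) = 1 := by
  rw [← diagonal_one, tensorPow_diagonal]
  simp

lemma trace_tensorPow (X : Matrix (Fin n) (Fin n) ℂ) :
    (tensorPow k X).trace = X.trace ^ k := by
  simp only [Matrix.trace, diag_apply, tensorPow_apply]
  rw [← Fintype.piFinset_univ, ← Finset.prod_univ_sum (fun _ => Finset.univ) fun _ a => X a a]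
  simp

lemma tensorPow_commute_permOp (X : Matrix (Fin n) (Fin n) ℂ) (σ : Equiv.Perm (Fin k)) :
    Commute (permOp n σ) (tensorPow k X) := by
  ext i j
  rw [permOp_mul_apply, mul_permOp_apply, tensorPow_apply, tensorPow_apply,
    ← Equiv.prod_comp σ (fun l => X (i l) _)]
  simp

/-- The unit circle contains an element of infinite order. -/
lemma exists_norm_one_injective_pow :
    ∃ z : ℂ, ‖z‖ = 1 ∧ Function.Injective (fun m : ℕ => z ^ m) := by
  refine ⟨Complex.exp Complex.I, by simp [Complex.norm_exp], fun p q hpq => ?_⟩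
  simp only [← Complex.exp_nat_mul] at hpq
  obtain ⟨r, hr⟩ := Complex.exp_eq_exp_iff_exists_int.1 hpq
  have hr' : (p : ℝ) = q + r * (2 * Real.pi) := by
    simpa using congrArg Complex.im hr
  by_cases hr0 : r = 0
  · subst hr0
    simpa using hr'
  · exfalso
    refine irrational_pi.ne_rat (((p : ℚ) - q) / (2 * r)) ?_
    have : (r : ℝ) ≠ 0 := by exact_mod_cast hr0
    push_cast
    field_simp
    linarith

variable {T : Matrix (Fin k → Fin n) (Fin k → Fin n) ℂ}

/-- A matrix commuting with tensor powers of unitary diagonal matrices preserves weights, hence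
commutes with tensor powers of all diagonal matrices. -/
lemma commute_tensorPow_diagonal
    (hT : ∀ U ∈ unitaryGroup (Fin n) ℂ, Commute T (tensorPow k U)) (d : Fin n → ℂ) :
    Commute T (tensorPow k (diagonal d)) := by
  have key : ∀ (e : Fin n → ℂ), Commute T (tensorPow k (diagonal e)) ↔
      ∀ i j, T i j ≠ 0 → ∏ l, e (j l) = ∏ l, e (i l) := by
    intro e
    rw [tensorPow_diagonal, commute_iff_eq, ← Matrix.ext_iff]
    simp only [mul_diagonal, diagonal_mul]
    refine forall₂_congr fun i j => ?_
    rw [mul_comm, mul_eq_mul_right_iff]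
    tauto
  rw [key]
  intro i j hij
  have hcount : ∀ a, (Finset.univ.filter fun l => j l = a).card =
      (Finset.univ.filter fun l => i l = a).card := by
    intro a
    obtain ⟨z, hz, hinj⟩ := exists_norm_one_injective_pow
    have hU : diagonal (fun b => if b = a then z else 1) ∈ unitaryGroup (Fin n) ℂ := by
      rw [mem_unitaryGroup_iff, star_eq_conjTranspose, diagonal_conjTranspose,
        diagonal_mul_diagonal, ← diagonal_one]
      congr 1
      ext b
      by_cases hb : b = a
      · simp [hb, Complex.mul_conj, Complex.normSq_eq_norm_sq, hz]
      · simp [hb]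
    have h := (key _).1 (hT _ hU) i j hij
    simp only [Finset.prod_ite, Finset.prod_const, one_pow, mul_one] at h
    exact hinj h
  have hprod : ∀ w : Fin k → Fin n, ∏ l, d (w l) =
      ∏ a, d a ^ (Finset.univ.filter fun l => w l = a).card := by
    intro w
    rw [← Finset.prod_fiberwise Finset.univ w]
    refine Finset.prod_congr rfl fun a _ => ?_
    rw [← Finset.prod_const]
    refine Finset.prod_congr rfl fun l hl => ?_
    rw [(Finset.mem_filter.1 hl).2]
  simp only [hprod, hcount]

open scoped ComplexOrder in
/-- An invertible complex matrix has a singular value decomposition. -/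
lemma exists_unitary_mul_diagonal_mul_unitary {X : Matrix (Fin n) (Fin n) ℂ} (hX : IsUnit X) :
    ∃ U ∈ unitaryGroup (Fin n) ℂ, ∃ V ∈ unitaryGroup (Fin n) ℂ, ∃ d : Fin n → ℂ,
      X = U * diagonal d * V := by
  have hpos : (Xᴴ * X).PosDef := Matrix.PosDef.conjTranspose_mul_self X
    (Matrix.mulVec_injective_iff_isUnit.2 hX)
  have hH := hpos.isHermitian
  have hspec := hH.spectral_theorem
  rw [Unitary.conjStarAlgAut_apply] at hspec
  set W := hH.eigenvectorUnitary
  have hW1 : star (W : Matrix (Fin n) (Fin n) ℂ) * W = 1 := Unitary.coe_star_mul_self W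
  have hW2 : (W : Matrix (Fin n) (Fin n) ℂ) * star (W : Matrix (Fin n) (Fin n) ℂ) = 1 :=
    Unitary.coe_mul_star_self W
  let s : Fin n → ℝ := fun i => Real.sqrt (hH.eigenvalues i)
  have hs : ∀ i, 0 < s i := fun i => Real.sqrt_pos.2 (hpos.eigenvalues_pos i)
  let D : Matrix (Fin n) (Fin n) ℂ := diagonal fun i => (s i : ℂ)
  let E : Matrix (Fin n) (Fin n) ℂ := diagonal fun i => ((s i)⁻¹ : ℂ)
  have hED : E * D = 1 := by
    simp only [E, D, diagonal_mul_diagonal, ← diagonal_one]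
    congr 1
    ext i
    exact inv_mul_cancel₀ (by exact_mod_cast (hs i).ne')
  have hE : star E = E := by
    simp only [E, star_eq_conjTranspose, diagonal_conjTranspose]
    congr 1
    ext i
    simp
  have hDD : diagonal (RCLike.ofReal ∘ hH.eigenvalues) = D * D := by
    simp only [D, diagonal_mul_diagonal]
    congr 1
    ext i
    simp only [Function.comp_apply, s, ← Complex.ofReal_mul,
      Real.mul_self_sqrt (hpos.eigenvalues_pos i).le]
    rfl
  have hDE : D * E = 1 := mul_eq_one_comm.1 hED
  refine ⟨X * W * E, ?_, star (W : Matrix (Fin n) (Fin n) ℂ), Unitary.star_mem W.2,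
    fun i => (s i : ℂ), ?_⟩
  · rw [mem_unitaryGroup_iff']
    calc star (X * W * E) * (X * W * E)
        = E * (star (W : Matrix (Fin n) (Fin n) ℂ) * (Xᴴ * X) * W) * E := by
          simp only [star_mul, hE, star_eq_conjTranspose, mul_assoc]
      _ = E * (star (W : Matrix (Fin n) (Fin n) ℂ) * W * (D * D) *
            (star (W : Matrix (Fin n) (Fin n) ℂ) * W)) * E := by
          rw [hspec, hDD]; simp only [mul_assoc]
      _ = E * D * (D * E) := by rw [hW1]; simp only [mul_assoc, one_mul, mul_one]
      _ = 1 := by rw [hED, hDE, one_mul]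
  · calc X = X * (W * (E * D) * star (W : Matrix (Fin n) (Fin n) ℂ)) := by
          rw [hED, mul_one, hW2, mul_one]
      _ = _ := by simp only [mul_assoc, D]

/-- A matrix commuting with tensor powers of unitaries commutes with all tensor powers. -/
lemma commute_tensorPow_of_unitary
    (hT : ∀ U ∈ unitaryGroup (Fin n) ℂ, Commute T (tensorPow k U))
    (X : Matrix (Fin n) (Fin n) ℂ) : Commute T (tensorPow k X) := by
  have hunit : ∀ X : Matrix (Fin n) (Fin n) ℂ, IsUnit X → Commute T (tensorPow k X) := by
    intro X hX
    obtain ⟨U, hU, V, hV, d, rfl⟩ := exists_unitary_mul_diagonal_mul_unitary hX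
    rw [tensorPow_mul, tensorPow_mul]
    exact ((hT U hU).mul_right (commute_tensorPow_diagonal hT d)).mul_right (hT V hV)
  have hcont : Continuous fun s : ℂ => tensorPow k (X + s • 1) := by
    refine continuous_matrix fun i j => ?_
    simp only [tensorPow_apply]
    fun_prop
  have hdense : Dense {s : ℂ | IsUnit (X + s • (1 : Matrix (Fin n) (Fin n) ℂ))} := by
    refine Dense.mono ?_ (Set.Countable.dense_compl ℂ (Polynomial.finite_setOfPred_isRoot
      (Matrix.charpoly_monic (-X)).ne_zero).countable)
    intro s hs
    simp only [Set.mem_compl_iff, Set.mem_ofPred_eq, Polynomial.IsRoot, Matrix.eval_charpoly] at hs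
    rw [Set.mem_ofPred_eq, Matrix.isUnit_iff_isUnit_det, isUnit_iff_ne_zero]
    convert hs using 3
    rw [sub_neg_eq_add, add_comm, Matrix.scalar_apply, smul_one_eq_diagonal]
  have hext : (fun s : ℂ => T * tensorPow k (X + s • 1)) = fun s => tensorPow k (X + s • 1) * T :=
    Continuous.ext_on hdense (continuous_const.matrix_mul hcont) (hcont.matrix_mul continuous_const)
      fun s hs => hunit _ hs
  rw [commute_iff_eq]
  simpa using congrFun hext 0

/-- Inclusion-exclusion expression for the permanent. -/
lemma sum_neg_one_pow_mul_prod_sum_compl (x : Fin k → Fin k → ℂ) :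
    ∑ S : Finset (Fin k), (-1 : ℂ) ^ S.card * ∏ m, ∑ l ∈ Sᶜ, x m l =
      ∑ σ : Equiv.Perm (Fin k), ∏ m, x m (σ m) := by
  have hS : ∀ S : Finset (Fin k), ∏ m, ∑ l ∈ Sᶜ, x m l =
      ∑ f : Fin k → Fin k, if S ⊆ (Finset.univ.image f)ᶜ then ∏ m, x m (f m) else 0 := by
    intro S
    rw [Finset.prod_univ_sum, ← Finset.sum_filter]
    refine Finset.sum_congr ?_ fun _ _ => rfl
    ext f
    simp only [Fintype.mem_piFinset, Finset.mem_compl, Finset.mem_filter, Finset.mem_univ,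
      true_and, Finset.subset_iff, Finset.mem_image, not_exists]
    exact ⟨fun h a ha m hm => h m (hm ▸ ha), fun h m hm => h hm m rfl⟩
  simp only [hS, Finset.mul_sum]
  rw [Finset.sum_comm]
  have hf : ∀ f : Fin k → Fin k, ∑ S : Finset (Fin k),
      (-1 : ℂ) ^ S.card * (if S ⊆ (Finset.univ.image f)ᶜ then ∏ m, x m (f m) else 0) =
      if Function.Surjective f then ∏ m, x m (f m) else 0 := by
    intro f
    have h := congrArg (Int.cast (R := ℂ))
      (Finset.sum_powerset_neg_one_pow_card (x := (Finset.univ.image f)ᶜ))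
    push_cast at h
    have hsurj : (Finset.univ.image f)ᶜ = ∅ ↔ Function.Surjective f := by
      rw [Finset.compl_eq_empty_iff, Finset.eq_univ_iff_forall]
      simp [Function.Surjective]
    simp only [hsurj] at h
    simp only [mul_ite, mul_zero]
    rw [← Finset.sum_filter, ← Finset.sum_mul]
    have hp : (Finset.univ.filter fun S : Finset (Fin k) => S ⊆ (Finset.univ.image f)ᶜ) =
        (Finset.univ.image f)ᶜ.powerset := by
      ext S; simp
    rw [hp, h]
    split_ifs <;> simp
  rw [Finset.sum_congr rfl fun f _ => hf f, ← Finset.sum_filter]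
  symm
  refine Finset.sum_bij (fun σ _ => ⇑σ) ?_ ?_ ?_ ?_
  · intro σ _
    simpa using σ.surjective
  · intro σ _ τ _ h
    exact DFunLike.coe_injective h
  · intro f hf
    have hf' : Function.Surjective f := by simpa using hf
    exact ⟨Equiv.ofBijective f (Finite.surjective_iff_bijective.1 hf'), Finset.mem_univ _, rfl⟩
  · intro σ _
    rfl

lemma prod_single_apply (a b i j : Fin k → Fin n) (σ : Equiv.Perm (Fin k)) :
    ∏ m, Matrix.single (a (σ m)) (b (σ m)) (1 : ℂ) (i m) (j m) =
      if a = i ∘ σ.symm then (if b = j ∘ σ.symm then 1 else 0) else 0 := by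
  simp only [Matrix.single_apply]
  rw [← ite_and, Finset.prod_ite_zero]
  simp only [Finset.prod_const_one, Finset.mem_univ, true_implies]
  refine if_congr ?_ rfl rfl
  rw [forall_and, Equiv.eq_comp_symm, Equiv.eq_comp_symm, funext_iff, funext_iff]
  rfl

/-- Permutation-invariant matrices are combinations of symmetrized elementary tensors. -/
lemma eq_sum_symmetrized_single_of_invariant {Y : Matrix (Fin k → Fin n) (Fin k → Fin n) ℂ}
    (hY : ∀ (σ : Equiv.Perm (Fin k)) i j, Y (i ∘ σ) (j ∘ σ) = Y i j) :
    Y = (k.factorial : ℂ)⁻¹ • ∑ ab : (Fin k → Fin n) × (Fin k → Fin n), Y ab.1 ab.2 •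
      (Matrix.of fun i j => ∑ σ : Equiv.Perm (Fin k),
        ∏ m, Matrix.single (ab.1 (σ m)) (ab.2 (σ m)) (1 : ℂ) (i m) (j m)) := by
  have hk : (k.factorial : ℂ) ≠ 0 := by exact_mod_cast k.factorial_ne_zero
  ext i j
  have hσ : ∀ σ : Equiv.Perm (Fin k), ∑ ab : (Fin k → Fin n) × (Fin k → Fin n), Y ab.1 ab.2 *
      (if ab.1 = i ∘ σ.symm then (if ab.2 = j ∘ σ.symm then 1 else 0) else 0) = Y i j := by
    intro σ
    rw [Fintype.sum_eq_single (i ∘ σ.symm, j ∘ σ.symm)]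
    · simp [hY]
    · rintro ⟨a, b⟩ hab
      rw [← ite_and, if_neg, mul_zero]
      simpa using hab
  simp only [Matrix.smul_apply, Matrix.sum_apply, Matrix.of_apply, smul_eq_mul, prod_single_apply,
    Finset.mul_sum (Finset.univ : Finset (Equiv.Perm (Fin k)))]
  rw [Finset.sum_comm, Finset.sum_congr rfl fun σ _ => hσ σ]
  simp [Fintype.card_perm, hk]

lemma commute_symmetrized
    (hT : ∀ U ∈ unitaryGroup (Fin n) ℂ, Commute T (tensorPow k U))
    (X : Fin k → Matrix (Fin n) (Fin n) ℂ) :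
    Commute T (Matrix.of fun i j => ∑ σ : Equiv.Perm (Fin k), ∏ m, X (σ m) (i m) (j m)) := by
  have : (Matrix.of fun i j => ∑ σ : Equiv.Perm (Fin k), ∏ m, X (σ m) (i m) (j m)) =
      ∑ S : Finset (Fin k), (-1 : ℂ) ^ S.card • tensorPow k (∑ l ∈ Sᶜ, X l) := by
    ext i j
    simp only [Matrix.of_apply, Matrix.sum_apply, Matrix.smul_apply, tensorPow_apply,
      smul_eq_mul]
    exact (sum_neg_one_pow_mul_prod_sum_compl fun m l => X l (i m) (j m)).symm
  rw [this]
  exact Commute.sum_right _ _ _ fun S _ => (commute_tensorPow_of_unitary hT _).smul_right _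

/-- A matrix commuting with tensor powers of unitaries commutes with all permutation-invariant
matrices. -/
lemma commute_of_invariant
    (hT : ∀ U ∈ unitaryGroup (Fin n) ℂ, Commute T (tensorPow k U))
    {Y : Matrix (Fin k → Fin n) (Fin k → Fin n) ℂ}
    (hY : ∀ (σ : Equiv.Perm (Fin k)) i j, Y (i ∘ σ) (j ∘ σ) = Y i j) : Commute T Y := by
  rw [eq_sum_symmetrized_single_of_invariant hY]
  refine Commute.smul_right (Commute.sum_right _ _ _ fun ab _ => Commute.smul_right ?_ _) _
  exact commute_symmetrized hT fun l => Matrix.single (ab.1 l) (ab.2 l) 1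

/-- **Schur–Weyl duality**: the commutant of the tensor powers of unitaries is spanned by the
permutation operators. -/
lemma mem_span_permOp_iff :
    T ∈ Submodule.span ℂ (Set.range (permOp (k := k) n)) ↔
      ∀ U ∈ unitaryGroup (Fin n) ℂ, Commute T (tensorPow k U) := by
  constructor
  · intro h U _
    induction h using Submodule.span_induction with
    | mem x hx =>
      obtain ⟨σ, rfl⟩ := hx
      exact tensorPow_commute_permOp U σ
    | zero => exact Commute.zero_left _
    | add x y _ _ hx hy => exact hx.add_left hy
    | smul a x _ hx => exact hx.smul_left a
  · intro hT
    set B := Submodule.span ℂ (Set.range (permOp (k := k) n))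
    have hk : (k.factorial : ℂ) ≠ 0 := by exact_mod_cast k.factorial_ne_zero
    have hmul : ∀ (σ : Equiv.Perm (Fin k)), ∀ Z ∈ B, permOp n σ * Z ∈ B := by
      intro σ Z hZ
      induction hZ using Submodule.span_induction with
      | mem x hx =>
        obtain ⟨τ, rfl⟩ := hx
        rw [← permOp_mul]
        exact Submodule.subset_span ⟨_, rfl⟩
      | zero => simp
      | add x y _ _ hx hy => rw [mul_add]; exact B.add_mem hx hy
      | smul a x _ hx => rw [mul_smul_comm]; exact B.smul_mem a hx
    obtain ⟨q, hq⟩ := B.exists_isCompl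
    let π : Matrix (Fin k → Fin n) (Fin k → Fin n) ℂ →ₗ[ℂ]
        Matrix (Fin k → Fin n) (Fin k → Fin n) ℂ :=
      B.subtype ∘ₗ B.projectionOnto q hq
    have hπmem : ∀ Z, π Z ∈ B := fun Z => (B.projectionOnto q hq Z).2
    have hπid : ∀ Z ∈ B, π Z = Z := fun Z hZ =>
      congrArg Subtype.val (Submodule.projectionOnto_apply_left hq ⟨Z, hZ⟩)
    let p : Matrix (Fin k → Fin n) (Fin k → Fin n) ℂ →ₗ[ℂ]
        Matrix (Fin k → Fin n) (Fin k → Fin n) ℂ :=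
      (k.factorial : ℂ)⁻¹ • ∑ σ : Equiv.Perm (Fin k),
        LinearMap.mulLeft ℂ (permOp n σ) ∘ₗ π ∘ₗ LinearMap.mulLeft ℂ (permOp n σ⁻¹)
    have hp_apply : ∀ Z, p Z = (k.factorial : ℂ)⁻¹ • ∑ σ : Equiv.Perm (Fin k),
        permOp n σ * π (permOp n σ⁻¹ * Z) := by
      intro Z; simp [p]
    have hpmem : ∀ Z, p Z ∈ B := by
      intro Z
      rw [hp_apply]
      exact B.smul_mem _ (B.sum_mem fun σ _ => hmul σ _ (hπmem _))
    have hpone : p 1 = 1 := by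
      rw [hp_apply]
      have : ∀ σ : Equiv.Perm (Fin k), permOp n σ * π (permOp n σ⁻¹ * 1) = 1 := by
        intro σ
        rw [mul_one, hπid _ (Submodule.subset_span ⟨_, rfl⟩), ← permOp_mul, mul_inv_cancel,
          permOp_one]
      simp only [this]
      rw [Finset.sum_const, Finset.card_univ, Fintype.card_perm, Fintype.card_fin,
        ← Nat.cast_smul_eq_nsmul ℂ, smul_smul, inv_mul_cancel₀ hk, one_smul]
    have hpcomm : ∀ τ Z, p (permOp n τ * Z) = permOp n τ * p Z := by
      intro τ Z
      rw [hp_apply, hp_apply, mul_smul_comm, Finset.mul_sum]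
      congr 1
      refine Fintype.sum_equiv (Equiv.mulLeft τ⁻¹) _ _ fun σ => ?_
      simp only [Equiv.coe_mulLeft, ← mul_assoc, ← permOp_mul, mul_inv_cancel, one_mul,
        _root_.mul_inv_rev, inv_inv]
    let Y : (Fin k → Fin n) → (Fin k → Fin n) → Matrix (Fin k → Fin n) (Fin k → Fin n) ℂ :=
      fun j l => Matrix.of fun i m => p (Matrix.single m l 1) i j
    have hY : ∀ j l, Commute T (Y j l) := by
      intro j l
      refine commute_of_invariant hT fun σ i m => ?_
      have hsingle : permOp n σ * Matrix.single (m ∘ σ) l 1 = Matrix.single m l 1 := by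
        ext a b
        rw [permOp_mul_apply, Matrix.single_apply, Matrix.single_apply]
        have : m ∘ σ = a ∘ σ ↔ m = a := σ.surjective.right_cancellable
        simp only [this]
      simp only [Y, Matrix.of_apply]
      rw [← hsingle, hpcomm, permOp_mul_apply]
    have hpY : ∀ Z i j, p Z i j = ∑ l, (Y j l * Z) i l := by
      intro Z i j
      conv_lhs => rw [Matrix.matrix_eq_sum_single Z]
      simp only [map_sum, Matrix.sum_apply, Matrix.mul_apply]
      rw [Finset.sum_comm]
      refine Finset.sum_congr rfl fun l _ => Finset.sum_congr rfl fun m _ => ?_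
      rw [show Matrix.single m l (Z m l) = Z m l • Matrix.single m l 1 by simp, map_smul]
      simp [Y, mul_comm]
    have hTp : p T = T * p 1 := by
      ext i j
      rw [hpY, Matrix.mul_apply]
      simp only [hpY, mul_one, Finset.mul_sum]
      rw [Finset.sum_comm]
      refine Finset.sum_congr rfl fun l _ => ?_
      rw [← (hY j l).eq, Matrix.mul_apply]
    rw [hpone, mul_one] at hTp
    rw [← hTp]
    exact hpmem T

end TensorPower

section HaarIntegral

variable {k n : ℕ}

lemma isCompact_unitaryGroup (n : ℕ) :
    IsCompact (unitaryGroup (Fin n) ℂ : Set (Matrix (Fin n) (Fin n) ℂ)) := by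
  have hclosed : IsClosed (unitaryGroup (Fin n) ℂ : Set (Matrix (Fin n) (Fin n) ℂ)) := by
    have : (unitaryGroup (Fin n) ℂ : Set (Matrix (Fin n) (Fin n) ℂ)) = {A | A * star A = 1} := by
      ext A
      exact mem_unitaryGroup_iff
    rw [this]
    exact isClosed_eq (by fun_prop) continuous_const
  refine IsCompact.of_isClosed_subset (isCompact_univ_pi fun _ : Fin n =>
    isCompact_univ_pi fun _ : Fin n => isCompact_closedBall (0 : ℂ) 1) hclosed ?_
  intro U hU i _ j _
  simpa using entry_norm_bound_of_unitary hU i j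

instance compactSpace_unitaryGroup (n : ℕ) : CompactSpace (unitaryGroup (Fin n) ℂ) :=
  isCompact_iff_compactSpace.1 (isCompact_unitaryGroup n)

lemma conjTranspose_tensorPow (X : Matrix (Fin n) (Fin n) ℂ) :
    (tensorPow k X)ᴴ = tensorPow k Xᴴ := by
  ext i j
  simp [tensorPow_apply]

lemma continuous_tensorPow : Continuous (tensorPow (n := n) k) := by
  refine continuous_matrix fun i j => ?_
  simp only [tensorPow_apply]
  fun_prop

lemma continuous_conj_tensorPow_apply (Z : Matrix (Fin k → Fin n) (Fin k → Fin n) ℂ)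
    (i j : Fin k → Fin n) : Continuous fun U : unitaryGroup (Fin n) ℂ =>
      (tensorPow k U.1 * Z * (tensorPow k U.1)ᴴ) i j := by
  have hK := (continuous_tensorPow (k := k) (n := n)).comp
    (continuous_subtype_val (p := fun U => U ∈ unitaryGroup (Fin n) ℂ))
  exact ((hK.matrix_mul continuous_const).matrix_mul hK.matrix_conjTranspose).matrix_elem i j

lemma tensorPow_mul_conjTranspose (V : unitaryGroup (Fin n) ℂ) :
    tensorPow k V.1 * (tensorPow k V.1)ᴴ = 1 := by
  rw [conjTranspose_tensorPow, ← tensorPow_mul, ← star_eq_conjTranspose,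
    mem_unitaryGroup_iff.1 V.2, tensorPow_one]

lemma norm_trace_unitary_le (U : unitaryGroup (Fin n) ℂ) : ‖U.1.trace‖ ≤ n := by
  refine (norm_sum_le _ _).trans ?_
  refine (Finset.sum_le_sum fun i _ => entry_norm_bound_of_unitary U.2 i i).trans ?_
  simp

lemma hasSum_exp_mul_exp_conj (t : ℝ) (z : ℂ) :
    HasSum (fun p : ℕ × ℕ => ((t : ℂ) ^ p.1 / p.1.factorial * ((t : ℂ) ^ p.2 / p.2.factorial)) *
      (z ^ p.1 * (starRingEnd ℂ) z ^ p.2)) (Real.exp (2 * t * z.re) : ℂ) := by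
  have hs : ∀ w : ℂ, HasSum (fun m : ℕ => w ^ m / m.factorial) (Complex.exp w) := by
    intro w
    rw [Complex.exp_eq_exp_ℂ]
    exact NormedSpace.expSeries_div_hasSum_exp w
  have hn : ∀ w : ℂ, Summable fun m : ℕ => ‖w ^ m / m.factorial‖ :=
    fun w => NormedSpace.norm_expSeries_div_summable w
  have hprod := summable_mul_of_summable_norm (hn (t * z)) (hn (t * (starRingEnd ℂ) z))
  have hp := (hs (t * z)).mul (hs (t * (starRingEnd ℂ) z)) hprod
  have hval : Complex.exp (t * z) * Complex.exp (t * (starRingEnd ℂ) z) =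
      (Real.exp (2 * t * z.re) : ℂ) := by
    rw [← Complex.exp_add, ← mul_add, Complex.add_conj, Complex.ofReal_exp]
    congr 1
    push_cast
    ring
  rw [hval] at hp
  refine hp.congr_fun fun p => ?_
  rw [mul_pow, mul_pow]
  ring

variable [MeasurableSpace (unitaryGroup (Fin n) ℂ)] [BorelSpace (unitaryGroup (Fin n) ℂ)]

lemma integral_trace_pow_mul_conj_trace_pow_of_ne
    (μ : Measure (unitaryGroup (Fin n) ℂ)) [μ.IsMulLeftInvariant] {a b : ℕ} (hab : a ≠ b) :
    ∫ U : unitaryGroup (Fin n) ℂ, U.1.trace ^ a * (starRingEnd ℂ) U.1.trace ^ b ∂μ = 0 := by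
  obtain ⟨z, hz, hinj⟩ := exists_norm_one_injective_pow
  have hzz : z * (starRingEnd ℂ) z = 1 := by
    rw [Complex.mul_conj, Complex.normSq_eq_norm_sq, hz]
    simp
  have hV : z • (1 : Matrix (Fin n) (Fin n) ℂ) ∈ unitaryGroup (Fin n) ℂ := by
    rw [mem_unitaryGroup_iff]
    simp [smul_smul, mul_comm, hzz]
  have h := integral_mul_left_eq_self (μ := μ) (fun U : unitaryGroup (Fin n) ℂ =>
    U.1.trace ^ a * (starRingEnd ℂ) U.1.trace ^ b) ⟨_, hV⟩
  have hscale : ∀ U : unitaryGroup (Fin n) ℂ,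
      ((⟨_, hV⟩ : unitaryGroup (Fin n) ℂ) * U).1.trace = z * U.1.trace := by
    intro U
    simp
  simp only [hscale, map_mul, mul_pow] at h
  simp only [mul_mul_mul_comm (z ^ a) _ ((starRingEnd ℂ) z ^ b)] at h
  rw [integral_const_mul] at h
  by_contra hne
  refine hab (hinj ?_)
  have h1 : z ^ a * (starRingEnd ℂ) z ^ b = 1 := mul_right_cancel₀ hne (by rw [h, one_mul])
  calc z ^ a = z ^ a * (z * (starRingEnd ℂ) z) ^ b := by rw [hzz, one_pow, mul_one]
    _ = z ^ a * (starRingEnd ℂ) z ^ b * z ^ b := by ring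
    _ = z ^ b := by rw [h1, one_mul]

lemma Continuous.integrable_unitaryGroup {μ : Measure (unitaryGroup (Fin n) ℂ)}
    [IsProbabilityMeasure μ] {f : unitaryGroup (Fin n) ℂ → ℂ} (hf : Continuous f) :
    Integrable f μ :=
  hf.integrable_of_hasCompactSupport (HasCompactSupport.of_compactSpace f)

/-- The average of `Z` under conjugation by tensor powers of unitaries. -/
noncomputable def twirl (k : ℕ) (μ : Measure (unitaryGroup (Fin n) ℂ)) [IsProbabilityMeasure μ] :
    Matrix (Fin k → Fin n) (Fin k → Fin n) ℂ →ₗ[ℂ] Matrix (Fin k → Fin n) (Fin k → Fin n) ℂ where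
  toFun Z := Matrix.of fun i j =>
    ∫ U : unitaryGroup (Fin n) ℂ, (tensorPow k U.1 * Z * (tensorPow k U.1)ᴴ) i j ∂μ
  map_add' Z W := by
    ext i j
    simp only [mul_add, add_mul, Matrix.of_apply, Matrix.add_apply]
    exact integral_add (continuous_conj_tensorPow_apply Z i j).integrable_unitaryGroup
      (continuous_conj_tensorPow_apply W i j).integrable_unitaryGroup
  map_smul' c Z := by
    ext i j
    simp only [mul_smul_comm, smul_mul_assoc, Matrix.of_apply, Matrix.smul_apply, RingHom.id_apply]
    exact integral_smul c _

variable (μ : Measure (unitaryGroup (Fin n) ℂ)) [IsProbabilityMeasure μ]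

lemma twirl_apply (Z : Matrix (Fin k → Fin n) (Fin k → Fin n) ℂ) (i j : Fin k → Fin n) :
    twirl k μ Z i j =
      ∫ U : unitaryGroup (Fin n) ℂ, (tensorPow k U.1 * Z * (tensorPow k U.1)ᴴ) i j ∂μ := rfl

lemma mul_twirl_mul (A C Z : Matrix (Fin k → Fin n) (Fin k → Fin n) ℂ) (i j : Fin k → Fin n) :
    (A * twirl k μ Z * C) i j = ∫ U : unitaryGroup (Fin n) ℂ,
      (A * (tensorPow k U.1 * Z * (tensorPow k U.1)ᴴ) * C) i j ∂μ := by
  have hc : ∀ a b, Continuous fun U : unitaryGroup (Fin n) ℂ =>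
      A i a * (tensorPow k U.1 * Z * (tensorPow k U.1)ᴴ) a b := fun a b =>
    continuous_const.mul (continuous_conj_tensorPow_apply Z a b)
  have hc' : ∀ b, Continuous fun U : unitaryGroup (Fin n) ℂ =>
      (∑ a, A i a * (tensorPow k U.1 * Z * (tensorPow k U.1)ᴴ) a b) * C b j := fun b =>
    (continuous_finsetSum _ fun a _ => hc a b).mul continuous_const
  simp only [Matrix.mul_apply (N := C), Matrix.mul_apply (M := A), twirl_apply]
  rw [integral_finsetSum _ fun b _ => (hc' b).integrable_unitaryGroup]
  refine Finset.sum_congr rfl fun b _ => ?_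
  rw [integral_mul_const, integral_finsetSum _ fun a _ => (hc a b).integrable_unitaryGroup]
  simp only [integral_const_mul]

lemma isProj_twirl [μ.IsMulLeftInvariant] :
    LinearMap.IsProj (Submodule.span ℂ (Set.range (permOp (k := k) n))) (twirl k μ) where
  map_mem Z := by
    rw [mem_span_permOp_iff]
    intro V hV
    have hinv : tensorPow k V * twirl k μ Z * (tensorPow k V)ᴴ = twirl k μ Z := by
      ext i j
      rw [mul_twirl_mul, twirl_apply]
      conv_rhs => rw [← integral_mul_left_eq_self _ (⟨V, hV⟩ : unitaryGroup _ ℂ)]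
      refine integral_congr_ae (Filter.Eventually.of_forall fun U => ?_)
      simp only [Submonoid.coe_mul, tensorPow_mul, conjTranspose_mul, mul_assoc]
    have hV' : (tensorPow k V)ᴴ * tensorPow k V = 1 :=
      mul_eq_one_comm.1 (tensorPow_mul_conjTranspose ⟨V, hV⟩)
    rw [commute_iff_eq]
    conv_lhs => rw [← hinv, mul_assoc, hV', mul_one]
  map_id T hT := by
    rw [mem_span_permOp_iff] at hT
    ext i j
    rw [twirl_apply]
    have : ∀ U : unitaryGroup (Fin n) ℂ, tensorPow k U.1 * T * (tensorPow k U.1)ᴴ = T := by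
      intro U
      rw [← (hT U.1 U.2).eq, mul_assoc, tensorPow_mul_conjTranspose, mul_one]
    simp [this]

lemma trace_twirl : LinearMap.trace ℂ _ (twirl k μ) =
    ∫ U : unitaryGroup (Fin n) ℂ, U.1.trace ^ k * (starRingEnd ℂ) U.1.trace ^ k ∂μ := by
  rw [LinearMap.trace_eq_matrix_trace ℂ (Matrix.stdBasis ℂ (Fin k → Fin n) (Fin k → Fin n)),
    Matrix.trace]
  have hentry : ∀ ab : (Fin k → Fin n) × (Fin k → Fin n),
      (LinearMap.toMatrix (Matrix.stdBasis ℂ (Fin k → Fin n) (Fin k → Fin n))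
        (Matrix.stdBasis ℂ (Fin k → Fin n) (Fin k → Fin n)) (twirl k μ)).diag ab =
      ∫ U : unitaryGroup (Fin n) ℂ,
        tensorPow k U.1 ab.1 ab.1 * (starRingEnd ℂ) (tensorPow k U.1 ab.2 ab.2) ∂μ := by
    rintro ⟨a, b⟩
    rw [diag_apply, LinearMap.toMatrix_apply, Matrix.stdBasis_eq_single]
    change twirl k μ (Matrix.single a b 1) a b = _
    rw [twirl_apply]
    refine integral_congr_ae (Filter.Eventually.of_forall fun U => ?_)
    simp [Matrix.mul_apply, Matrix.single_apply, Finset.sum_ite_eq, ite_and]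
  have hK : ∀ a, Continuous fun U : unitaryGroup (Fin n) ℂ => tensorPow k U.1 a a := fun a =>
    (continuous_tensorPow.comp continuous_subtype_val).matrix_elem a a
  rw [Finset.sum_congr rfl fun ab _ => hentry ab, ← integral_finsetSum _ fun ab _ =>
    ((hK ab.1).mul (Complex.continuous_conj.comp (hK ab.2))).integrable_unitaryGroup]
  refine integral_congr_ae (Filter.Eventually.of_forall fun U => ?_)
  simp only [← map_pow, ← trace_tensorPow]
  rw [Fintype.sum_prod_type, Matrix.trace, map_sum, Finset.sum_mul_sum]
  rfl

/-- The even moments of the trace of a Haar unitary count permutations by their longest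
increasing subsequence. -/
theorem integral_trace_pow_mul_conj_trace_pow [μ.IsMulLeftInvariant] (k : ℕ) :
    ∫ U : unitaryGroup (Fin n) ℂ, U.1.trace ^ k * (starRingEnd ℂ) U.1.trace ^ k ∂μ = u k n := by
  rw [← trace_twirl, (isProj_twirl μ).trace, finrank_span_permOp]

end HaarIntegral

/-- For every `n ≥ 1` and real `t`, the integral of `U ↦ exp(2t·Re(tr U)) = exp(t·tr(U+U*))`
over the unitary group `U(n)` with respect to the Haar probability measure equals the sum of
the absolutely convergent series `Σ_k t^(2k)/(k!)² · u_k(n)`. -/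
theorem unitary_integral_eq_poissonized_LIS_series
    (n : ℕ) (hn : 1 ≤ n) (t : ℝ)
    [MeasurableSpace (unitaryGroup (Fin n) ℂ)] [BorelSpace (unitaryGroup (Fin n) ℂ)]
    (μ : Measure (unitaryGroup (Fin n) ℂ)) [μ.IsHaarMeasure] [IsProbabilityMeasure μ] :
    Summable (fun k : ℕ => t ^ (2 * k) / ((k.factorial : ℝ)) ^ 2 * (u k n : ℝ)) ∧
    ∫ U : unitaryGroup (Fin n) ℂ,
        Real.exp (2 * t * (Matrix.trace (U : Matrix (Fin n) (Fin n) ℂ)).re) ∂μ =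
      ∑' k : ℕ, t ^ (2 * k) / ((k.factorial : ℝ)) ^ 2 * (u k n : ℝ) := by
  let F : ℕ × ℕ → unitaryGroup (Fin n) ℂ → ℂ := fun p U =>
    ((t : ℂ) ^ p.1 / p.1.factorial * ((t : ℂ) ^ p.2 / p.2.factorial)) *
      (U.1.trace ^ p.1 * (starRingEnd ℂ) U.1.trace ^ p.2)
  have htr : Continuous fun U : unitaryGroup (Fin n) ℂ => U.1.trace :=
    continuous_subtype_val.matrix_trace
  have hF_int : ∀ p, Integrable (F p) μ := fun p =>
    Continuous.integrable_unitaryGroup (continuous_const.mul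
      ((htr.pow _).mul ((Complex.continuous_conj.comp htr).pow _)))
  have hF_sum : Summable fun p => ∫ U, ‖F p U‖ ∂μ := by
    have hexp := Real.summable_pow_div_factorial (|t| * n)
    refine Summable.of_nonneg_of_le (fun p => integral_nonneg fun U => norm_nonneg _) (fun p => ?_)
      (hexp.mul_of_nonneg hexp (fun _ => by positivity) (fun _ => by positivity))
    have hbound : ∀ U, ‖F p U‖ ≤ (|t| * n) ^ p.1 / p.1.factorial *
        ((|t| * n) ^ p.2 / p.2.factorial) := by
      intro U
      have hU := norm_trace_unitary_le U
      calc ‖F p U‖ = (|t| * ‖U.1.trace‖) ^ p.1 / p.1.factorial *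
            ((|t| * ‖U.1.trace‖) ^ p.2 / p.2.factorial) := by
            simp only [F, norm_mul, norm_div, norm_pow, Complex.norm_real, Real.norm_eq_abs,
              Complex.norm_natCast, RCLike.norm_conj]
            ring
        _ ≤ _ := by gcongr
    refine (integral_mono (hF_int p).norm (integrable_const _) hbound).trans ?_
    simp
  have hsum := hasSum_integral_of_summable_integral_norm hF_int hF_sum
  have hdiag : ∀ p : ℕ × ℕ, p ∉ Set.range (fun m : ℕ => (m, m)) → ∫ U, F p U ∂μ = 0 := by
    rintro ⟨a, b⟩ hp
    have hab : a ≠ b := fun h => hp ⟨a, by rw [h]⟩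
    simp only [F, integral_const_mul, integral_trace_pow_mul_conj_trace_pow_of_ne μ hab, mul_zero]
  rw [← Function.Injective.hasSum_iff (fun a b h => (Prod.mk.inj h).1) hdiag] at hsum
  have hterm : (fun p => ∫ U, F p U ∂μ) ∘ (fun m : ℕ => (m, m)) = fun m : ℕ =>
      ((t ^ (2 * m) / (m.factorial : ℝ) ^ 2 * (u m n : ℝ) : ℝ) : ℂ) := by
    ext m
    simp only [F, Function.comp_apply, integral_const_mul,
      integral_trace_pow_mul_conj_trace_pow μ m]
    push_cast
    ring
  have hval : ∫ U, ∑' p, F p U ∂μ = ((∫ U : unitaryGroup (Fin n) ℂ,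
      Real.exp (2 * t * (Matrix.trace (U : Matrix (Fin n) (Fin n) ℂ)).re) ∂μ : ℝ) : ℂ) := by
    rw [← integral_complex_ofReal]
    exact integral_congr_ae (Filter.Eventually.of_forall fun U =>
      (hasSum_exp_mul_exp_conj t U.1.trace).tsum_eq)
  rw [hterm, hval, Complex.hasSum_ofReal] at hsum
  exact ⟨hsum.summable, hsum.tsum_eq.symm⟩
end

section
/- Fix a real t. For every n ≥ 0 the series Σ_{k=0}^∞ t^{2k}/(k!)² · u_k(n) converges absolutely; the map n ↦ e^{-t²} Σ_{k=0}^∞ t^{2k}/(k!)² · u_k(n) is nondecreasing in n, takes values in [0,1], and converges to 1 as n → ∞. (Hence n ↦ e^{-t²} Σ_k t^{2k} u_k(n)/(k!)² is a probability distribution function on ℕ, namely that of the Poissonized longest increasing subsequence length.) -/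
open Filter

theorem LIS_le {k : ℕ} (σ : Equiv.Perm (Fin k)) : LIS σ ≤ k := by
  refine Finset.sup_le fun A _ => ?_
  split_ifs
  · simpa using A.card_le_univ
  · exact Nat.zero_le k

theorem u_mono (k : ℕ) : Monotone (u k) := fun _ _ h =>
  Finset.card_le_card (Finset.monotone_filter_right _ fun _ _ hσ => hσ.trans h)

theorem u_le_factorial (k n : ℕ) : u k n ≤ k.factorial := by
  simpa [u, Fintype.card_perm] using
    Finset.card_filter_le Finset.univ fun σ : Equiv.Perm (Fin k) => LIS σ ≤ n

theorem u_eq_factorial {k n : ℕ} (h : k ≤ n) : u k n = k.factorial := by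
  rw [u, Finset.filter_true_of_mem fun σ _ => (LIS_le σ).trans h, Finset.card_univ,
    Fintype.card_perm, Fintype.card_fin]

theorem pow_div_factorial_sq_mul_factorial (t : ℝ) (k : ℕ) :
    t ^ (2 * k) / (k.factorial : ℝ) ^ 2 * k.factorial = (t ^ 2) ^ k / k.factorial := by
  have := k.factorial_ne_zero
  field_simp
  rw [pow_mul]

theorem poissonized_coeff_nonneg (t : ℝ) (k : ℕ) :
    0 ≤ t ^ (2 * k) / (k.factorial : ℝ) ^ 2 := by
  rw [pow_mul]
  positivity

theorem poissonized_term_le (t : ℝ) (k n : ℕ) :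
    t ^ (2 * k) / (k.factorial : ℝ) ^ 2 * u k n ≤ (t ^ 2) ^ k / k.factorial := by
  rw [← pow_div_factorial_sq_mul_factorial]
  exact mul_le_mul_of_nonneg_left (mod_cast u_le_factorial k n) (poissonized_coeff_nonneg t k)

/-- For fixed real `t`, the series `Σ_k t^(2k)/(k!)² · u_k(n)` converges absolutely for every
`n`, and `n ↦ e^{-t²} Σ_k t^(2k)/(k!)² · u_k(n)` is a nondecreasing `[0,1]`-valued function
tending to `1` as `n → ∞`: it is the distribution function of the Poissonized length of the
longest increasing subsequence. -/
theorem poissonized_LIS_distribution_function (t : ℝ) :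
    (∀ n : ℕ, Summable (fun k : ℕ => t ^ (2 * k) / ((k.factorial : ℝ)) ^ 2 * (u k n : ℝ))) ∧
    Monotone (fun n : ℕ =>
      Real.exp (-t ^ 2) * ∑' k : ℕ, t ^ (2 * k) / ((k.factorial : ℝ)) ^ 2 * (u k n : ℝ)) ∧
    (∀ n : ℕ,
      Real.exp (-t ^ 2) * (∑' k : ℕ, t ^ (2 * k) / ((k.factorial : ℝ)) ^ 2 * (u k n : ℝ))
        ∈ Set.Icc (0 : ℝ) 1) ∧
    Tendsto (fun n : ℕ =>
      Real.exp (-t ^ 2) * ∑' k : ℕ, t ^ (2 * k) / ((k.factorial : ℝ)) ^ 2 * (u k n : ℝ))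
      atTop (nhds 1) := by
  have hnonneg (n k : ℕ) : 0 ≤ t ^ (2 * k) / (k.factorial : ℝ) ^ 2 * (u k n : ℝ) :=
    mul_nonneg (poissonized_coeff_nonneg t k) (Nat.cast_nonneg _)
  have hexp : HasSum (fun k : ℕ => (t ^ 2) ^ k / (k.factorial : ℝ)) (Real.exp (t ^ 2)) := by
    rw [Real.exp_eq_exp_ℝ]
    exact NormedSpace.expSeries_div_hasSum_exp (t ^ 2)
  have hsum (n : ℕ) :
      Summable (fun k : ℕ => t ^ (2 * k) / ((k.factorial : ℝ)) ^ 2 * (u k n : ℝ)) :=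
    hexp.summable.of_nonneg_of_le (hnonneg n) fun k => poissonized_term_le t k n
  have hone : Real.exp (-t ^ 2) * Real.exp (t ^ 2) = 1 := by
    rw [← Real.exp_add, neg_add_cancel, Real.exp_zero]
  refine ⟨hsum, fun m n hmn => ?_, fun n => ⟨?_, ?_⟩, ?_⟩
  · exact mul_le_mul_of_nonneg_left ((hsum m).tsum_le_tsum (fun k =>
      mul_le_mul_of_nonneg_left (mod_cast u_mono k hmn) (poissonized_coeff_nonneg t k)) (hsum n))
      (Real.exp_nonneg _)
  · exact mul_nonneg (Real.exp_nonneg _) (tsum_nonneg (hnonneg n))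
  · rw [← hone, ← hexp.tsum_eq]
    exact mul_le_mul_of_nonneg_left
      ((hsum n).tsum_le_tsum (fun k => poissonized_term_le t k n) hexp.summable)
      (Real.exp_nonneg _)
  · rw [← hone, ← hexp.tsum_eq]
    refine Tendsto.const_mul _ (tendsto_tsum_of_dominated_convergence hexp.summable
      (fun k => tendsto_const_nhds.congr' ?_) (Eventually.of_forall fun n k => ?_))
    · filter_upwards [eventually_ge_atTop k] with n hn
      rw [u_eq_factorial hn, pow_div_factorial_sq_mul_factorial]
    · rw [Real.norm_of_nonneg (hnonneg n k)]
      exact poissonized_term_le t k n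
end

section
/- For all integers n and x and every real t, the family (F_{n-1}(y,t))_{y ≥ x, y ∈ ℤ} is summable and F_n(x,t) = Σ_{y=x}^{∞} F_{n-1}(y,t). -/
open Complex

/-- `F_n(x,t) = (1/(2πi)) ∮_{|w|=r} e^{t(w-1)} w^{-(x-n+1)} (w-1)^{-n} dw`, the value being
independent of the radius `r > 1`; here we take `r = 2`. -/
noncomputable def F (n x : ℤ) (t : ℝ) : ℂ :=
  (2 * (Real.pi : ℂ) * Complex.I)⁻¹ *
    ∮ w in C(0, 2), Complex.exp ((t : ℂ) * (w - 1)) * w ^ (-(x - n + 1)) * (w - 1) ^ (-n)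

/-- The integers at least `x`, enumerated as `x, x + 1, x + 2, …`. -/
def natEquivIntGe (x : ℤ) : ℕ ≃ {y : ℤ // x ≤ y} where
  toFun k := ⟨x + k, by omega⟩
  invFun y := (y.1 - x).toNat
  left_inv k := by simp
  right_inv y := Subtype.ext (by have := y.2; simp only; omega)

theorem ne_zero_and_sub_one_ne_zero_of_mem_sphere {w : ℂ} (hw : w ∈ Metric.sphere (0 : ℂ) 2) :
    w ≠ 0 ∧ w - 1 ≠ 0 := by
  rw [mem_sphere_zero_iff_norm] at hw
  constructor
  · rintro rfl
    norm_num at hw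
  · intro h
    rw [sub_eq_zero.mp h] at hw
    norm_num at hw

theorem circleIntegrable_exp_mul_zpow_mul_sub_one_zpow (t : ℝ) (a b : ℤ) :
    CircleIntegrable (fun w : ℂ => exp (t * (w - 1)) * w ^ a * (w - 1) ^ b) 0 2 := by
  refine ContinuousOn.circleIntegrable zero_le_two ?_
  refine ContinuousOn.mul (ContinuousOn.mul (by fun_prop) ?_) ?_
  · exact continuousOn_id.zpow₀ _
      fun w hw => Or.inl (ne_zero_and_sub_one_ne_zero_of_mem_sphere hw).1
  · exact (continuousOn_id.sub continuousOn_const).zpow₀ _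
      fun w hw => Or.inl (ne_zero_and_sub_one_ne_zero_of_mem_sphere hw).2

theorem hasSum_F_prev (n x : ℤ) (t : ℝ) :
    HasSum (fun k : ℕ => F (n - 1) (x + k) t) (F n x t) := by
  have hsum := (hasSum_two_pi_I_cauchyPowerSeries_integral (w := 1)
    (circleIntegrable_exp_mul_zpow_mul_sub_one_zpow t (-(x - n + 1)) (-(n - 1)))
    (by simp)).mul_left (2 * (Real.pi : ℂ) * I)⁻¹
  unfold F
  convert hsum using 1
  · rfl
  · funext k
    refine congrArg ((2 * (Real.pi : ℂ) * I)⁻¹ * ·)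
      (circleIntegral.integral_congr zero_le_two fun w hw => ?_)
    obtain ⟨hw₀, -⟩ := ne_zero_and_sub_one_ne_zero_of_mem_sphere hw
    have hexp : -(x + k - (n - 1) + 1) = -(x - n + 1) + (-(k : ℤ) + -1) := by ring
    simp only [hexp, zpow_add₀ hw₀, zpow_neg w (k : ℤ), zpow_natCast, zpow_neg_one, sub_zero,
      one_div, inv_pow, smul_eq_mul]
    ring
  · refine congrArg ((2 * (Real.pi : ℂ) * I)⁻¹ * ·)
      (circleIntegral.integral_congr zero_le_two fun w hw => ?_)
    obtain ⟨-, hw₁⟩ := ne_zero_and_sub_one_ne_zero_of_mem_sphere hw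
    have hexp : -n = -(n - 1) + -1 := by ring
    simp only [zero_add, smul_eq_mul]
    rw [hexp, zpow_add₀ hw₁, zpow_neg_one]
    ring

/-- The family `(F_{n-1}(y,t))_{y ≥ x}` is summable and `F_n(x,t) = Σ_{y ≥ x} F_{n-1}(y,t)`. -/
theorem F_eq_tsum_of_prev (n x : ℤ) (t : ℝ) :
    Summable (fun y : {y : ℤ // x ≤ y} => F (n - 1) (y : ℤ) t) ∧
    F n x t = ∑' y : {y : ℤ // x ≤ y}, F (n - 1) (y : ℤ) t := by
  have h : HasSum (fun y : {y : ℤ // x ≤ y} => F (n - 1) (y : ℤ) t) (F n x t) :=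
    (natEquivIntGe x).hasSum_iff.mp (hasSum_F_prev n x t)
  exact ⟨h.summable, h.tsum_eq.symm⟩
end
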